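/- lim_{k→∞} 4·k·η_k²·g_k(η_k)/ψ_k(η_k) = 1/2; consequently, in regular expressions without Σ⋆ in unions, the asymptotic ratio lim_{n→∞} ℓ_n/(n·R_n) of letters tends to 1/2 as the alphabet size k tends to ∞. -/

import Mathlib

open Filter Set

/-- Regular expressions over an alphabet `A` (grammar β := ε | σ | β+β | β·β | β⋆). -/
inductive RegEx (A : Type) : Type where
  | eps : RegEx A
  | char (a : A) : RegEx A
  | plus (l r : RegEx A) : RegEx A
  | cat (l r : RegEx A) : RegEx A
  | star (e : RegEx A) : RegEx A

namespace RegEx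

/-- The (tree-)size of an expression: number of symbols / syntax-tree nodes. -/
def size {A : Type} : RegEx A → ℕ
  | eps => 1
  | char _ => 1
  | plus l r => size l + size r + 1
  | cat l r => size l + size r + 1
  | star e => size e + 1

/-- The number of letter occurrences (alphabetic size). -/
def letters {A : Type} : RegEx A → ℕ
  | eps => 0
  | char _ => 1
  | plus l r => letters l + letters r
  | cat l r => letters l + letters r
  | star e => letters e

/-- `IsUnionOfLetters e l` : `e` is a binary union tree whose leaves are single letters,
read from left to right giving the list `l`. -/
inductive IsUnionOfLetters {A : Type} : RegEx A → List A → Prop where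
  | char (a : A) : IsUnionOfLetters (char a) [a]
  | plus {l r : RegEx A} {ll rl : List A} :
      IsUnionOfLetters l ll → IsUnionOfLetters r rl →
      IsUnionOfLetters (plus l r) (ll ++ rl)

/-- `e` is of the form `(σ_{i₁}+⋯+σ_{i_k})⋆` where `σ_{i₁},…,σ_{i_k}` is a permutation of
the (finite) alphabet `A`. -/
def IsSigmaStar {A : Type} [Fintype A] (e : RegEx A) : Prop :=
  ∃ (f : RegEx A) (l : List A),
    e = star f ∧ IsUnionOfLetters f l ∧ l.Nodup ∧ ∀ a : A, a ∈ l

/-- The absorbing pattern `Σ⋆` does not occur in `e` as an argument of a union. -/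
def Avoids {A : Type} [Fintype A] : RegEx A → Prop
  | eps => True
  | char _ => True
  | plus l r => Avoids l ∧ Avoids r ∧ ¬ IsSigmaStar l ∧ ¬ IsSigmaStar r
  | cat l r => Avoids l ∧ Avoids r
  | star e => Avoids e

end RegEx

/-- Number of expressions in `REna` (over a `k`-letter alphabet) of size `n`. -/
noncomputable def Rcount (k n : ℕ) : ℕ :=
  Nat.card {e : RegEx (Fin k) // RegEx.Avoids e ∧ RegEx.size e = n}

/-- Number of all regular expressions (over a `k`-letter alphabet) of size `n`. -/
noncomputable def Bcount (k n : ℕ) : ℕ :=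
  Nat.card {e : RegEx (Fin k) // RegEx.size e = n}

/-- Total number of letter occurrences over all expressions in `REna` of size `n`. -/
noncomputable def Lcount (k n : ℕ) : ℕ :=
  Nat.card {p : RegEx (Fin k) × ℕ //
    RegEx.Avoids p.1 ∧ RegEx.size p.1 = n ∧ p.2 < RegEx.letters p.1}

/-- `C_k = (2k-2)!/(k-1)!` as a real number. -/
noncomputable def Cc (k : ℕ) : ℝ :=
  ((2 * k - 2).factorial : ℝ) / ((k - 1).factorial : ℝ)

/-- `p_k(z) = 1 − 2z − (7+8k)z²`. -/
noncomputable def Pp (k : ℕ) (z : ℝ) : ℝ := 1 - 2 * z - (7 + 8 * k) * z ^ 2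

/-- `h_k(z) = 1 − z − C_k·z^{2k+1}`. -/
noncomputable def Hh (k : ℕ) (z : ℝ) : ℝ := 1 - z - Cc k * z ^ (2 * k + 1)

/-- `Δ_k(z) = p_k(z) + 4·C_k·z^{2k+1}·h_k(z)`. -/
noncomputable def Dd (k : ℕ) (z : ℝ) : ℝ :=
  Pp k z + 4 * Cc k * z ^ (2 * k + 1) * Hh k z

/-- `g_k(z) = 2 − C_k·z^{2k−1}·(h_k(z) − C_k·z^{2k−1})`. -/
noncomputable def Gg (k : ℕ) (z : ℝ) : ℝ :=
  2 - Cc k * z ^ (2 * k - 1) * (Hh k z - Cc k * z ^ (2 * k - 1))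

/-- `ρ_k = 1/(1+√(8+8k))`, the positive root of `p_k`. -/
noncomputable def rho (k : ℕ) : ℝ := 1 / (1 + Real.sqrt (8 + 8 * k))

/-- `ψ_k(x) = −x·Δ_k′(x)`. -/
noncomputable def psi (k : ℕ) (x : ℝ) : ℝ := -x * deriv (Dd k) x

/-- `η` is a root of `Δ_k` in the interval `(0, 1/√(8+8k))`, and is the unique such root. -/
def IsEta (k : ℕ) (η : ℝ) : Prop :=
  η ∈ Set.Ioo (0 : ℝ) (1 / Real.sqrt (8 + 8 * k)) ∧ Dd k η = 0 ∧
    ∀ x ∈ Set.Ioo (0 : ℝ) (1 / Real.sqrt (8 + 8 * k)), Dd k x = 0 → x = η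

theorem Cc_nonneg (k : ℕ) : 0 ≤ Cc k := by unfold Cc; positivity

theorem Cc_le (k : ℕ) (hk : 1 ≤ k) : Cc k ≤ (2 * k : ℝ) ^ (k - 1) := by
  unfold Cc
  rw [div_le_iff₀ (by positivity)]
  have h1 := Nat.factorial_mul_ascFactorial (k - 1) (k - 1)
  have h2 := Nat.ascFactorial_le_pow_add (k - 1) (k - 1)
  have h3 : 2 * k - 2 = k - 1 + (k - 1) := by omega
  have h4 : (2 * k - 2).factorial ≤ (2 * k) ^ (k - 1) * (k - 1).factorial := by
    rw [h3, ← h1, mul_comm]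
    exact Nat.mul_le_mul_right _ (h2.trans (Nat.pow_le_pow_left (by omega) _))
  exact_mod_cast h4

/-- On `(0, 1/√(8+8k))` the coefficient `C_k x^{2k-1}` is exponentially small in `k`. -/
theorem Cc_mul_pow_le {k : ℕ} (hk : 2 ≤ k) {x : ℝ}
    (hx : x ∈ Set.Ioo (0 : ℝ) (1 / Real.sqrt (8 + 8 * k))) :
    Cc k * x ^ (2 * k - 1) ≤ 4 * (1 / 4 : ℝ) ^ k := by
  obtain ⟨h0, h1⟩ := hx
  have hs : 0 < Real.sqrt (8 + 8 * k) := by positivity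
  have hsq : x ^ 2 ≤ 1 / (8 + 8 * k) := by
    have := pow_le_pow_left₀ h0.le h1.le 2
    rwa [div_pow, one_pow, Real.sq_sqrt (by positivity)] at this
  have hx1 : x ≤ 1 := by
    have : (1 : ℝ) / (8 + 8 * k) ≤ 1 := by
      rw [div_le_one (by positivity)]
      linarith [(Nat.cast_nonneg k : (0 : ℝ) ≤ k)]
    nlinarith
  have e1 : 2 * k - 1 = 2 * (k - 1) + 1 := by omega
  have e2 : (4 : ℝ) * (1 / 4) ^ k = (1 / 4) ^ (k - 1) := by
    obtain ⟨j, rfl⟩ : ∃ j, k = j + 1 := ⟨k - 1, by omega⟩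
    rw [Nat.add_sub_cancel, pow_succ]
    ring
  have hprod : (2 * k : ℝ) * x ^ 2 ≤ 1 / 4 := by
    calc (2 * k : ℝ) * x ^ 2 ≤ 2 * k * (1 / (8 + 8 * k)) := by gcongr
      _ ≤ 1 / 4 := by
        rw [mul_one_div, div_le_div_iff₀ (by positivity) (by norm_num)]
        linarith
  rw [e2, e1, pow_succ, pow_mul]
  calc Cc k * ((x ^ 2) ^ (k - 1) * x) ≤ (2 * k : ℝ) ^ (k - 1) * ((x ^ 2) ^ (k - 1) * 1) := by
        gcongr
        exact Cc_le k (by omega)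
    _ = ((2 * k : ℝ) * x ^ 2) ^ (k - 1) := by rw [mul_one, ← mul_pow]
    _ ≤ (1 / 4) ^ (k - 1) := by gcongr

theorem psi_eq {k : ℕ} (hk : 1 ≤ k) (x : ℝ) :
    psi k x = 2 * x + 14 * x ^ 2 + 16 * (k * x ^ 2)
      - 4 * (2 * (k * (Cc k * x ^ (2 * k - 1))) + Cc k * x ^ (2 * k - 1)) * x ^ 2 * Hh k x
      + 4 * (Cc k * x ^ (2 * k - 1)) * x ^ 3 * (1 + (2 * (k * (Cc k * x ^ (2 * k - 1)))
        + Cc k * x ^ (2 * k - 1)) * x) := by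
  have hp : HasDerivAt (Pp k) (-2 - (7 + 8 * k) * (2 * x)) x := by
    unfold Pp
    refine ((((hasDerivAt_id x).const_mul 2).const_sub 1).sub
      (((hasDerivAt_id x).pow 2).const_mul (7 + 8 * (k : ℝ)))).congr_deriv ?_
    simp
  have hm : HasDerivAt (fun z : ℝ => z ^ (2 * k + 1)) ((2 * k + 1) * x ^ (2 * k)) x := by
    simpa using hasDerivAt_pow (2 * k + 1) x
  have hh : HasDerivAt (Hh k) (-1 - Cc k * ((2 * k + 1) * x ^ (2 * k))) x := by
    unfold Hh
    exact ((hasDerivAt_id x).const_sub 1).sub (hm.const_mul (Cc k))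
  have hd : HasDerivAt (Dd k) (-2 - (7 + 8 * k) * (2 * x)
      + (4 * Cc k * ((2 * k + 1) * x ^ (2 * k)) * Hh k x
        + 4 * Cc k * x ^ (2 * k + 1) * (-1 - Cc k * ((2 * k + 1) * x ^ (2 * k))))) x := by
    unfold Dd
    exact hp.add ((hm.const_mul (4 * Cc k)).mul hh)
  have e1 : x ^ (2 * k) = x ^ (2 * k - 1) * x := by
    rw [← pow_succ]
    congr 1
    omega
  rw [psi, hd.deriv, pow_succ, e1]
  ring

theorem tendsto_letters_ratio (η : ℕ → ℝ) (hη : ∀ k, 2 ≤ k → IsEta k (η k)) :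
    Tendsto (fun k : ℕ => 4 * (k : ℝ) * η k ^ 2 * Gg k (η k) / psi k (η k))
      atTop (nhds (1 / 2)) := by
  set c : ℕ → ℝ := fun k => Cc k * η k ^ (2 * k - 1) with hc
  have hc0 : ∀ k, 2 ≤ k → 0 ≤ c k := fun k hk =>
    mul_nonneg (Cc_nonneg k) (pow_nonneg (hη k hk).1.1.le _)
  have hc1 : ∀ k, 2 ≤ k → c k ≤ 4 * (1 / 4 : ℝ) ^ k := fun k hk => Cc_mul_pow_le hk (hη k hk).1
  have hkη : Tendsto η atTop (nhds 0) := by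
    have hlim : Tendsto (fun k : ℕ => 1 / Real.sqrt (8 + 8 * k)) atTop (nhds 0) := by
      simp_rw [one_div]
      refine tendsto_inv_atTop_zero.comp (Real.tendsto_sqrt_atTop.comp ?_)
      exact tendsto_atTop_add_const_left _ _
        (tendsto_natCast_atTop_atTop.const_mul_atTop (by norm_num))
    refine tendsto_of_tendsto_of_tendsto_of_le_of_le' tendsto_const_nhds hlim ?_ ?_
    · filter_upwards [eventually_ge_atTop 2] with k hk using (hη k hk).1.1.le
    · filter_upwards [eventually_ge_atTop 2] with k hk using (hη k hk).1.2.le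
  have hclim : Tendsto c atTop (nhds 0) := by
    have hlim : Tendsto (fun k : ℕ => 4 * (1 / 4 : ℝ) ^ k) atTop (nhds 0) := by
      simpa using (tendsto_pow_atTop_nhds_zero_of_lt_one (r := (1 / 4 : ℝ))
        (by norm_num) (by norm_num)).const_mul 4
    refine tendsto_of_tendsto_of_tendsto_of_le_of_le' tendsto_const_nhds hlim ?_ ?_
    · filter_upwards [eventually_ge_atTop 2] with k hk using hc0 k hk
    · filter_upwards [eventually_ge_atTop 2] with k hk using hc1 k hk
  have hkclim : Tendsto (fun k : ℕ => (k : ℝ) * c k) atTop (nhds 0) := by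
    have hlim : Tendsto (fun k : ℕ => 4 * ((k : ℝ) * (1 / 4 : ℝ) ^ k)) atTop (nhds 0) := by
      simpa using (tendsto_self_mul_const_pow_of_lt_one (r := (1 / 4 : ℝ))
        (by norm_num) (by norm_num)).const_mul 4
    refine tendsto_of_tendsto_of_tendsto_of_le_of_le' tendsto_const_nhds hlim ?_ ?_
    · filter_upwards [eventually_ge_atTop 2] with k hk
      exact mul_nonneg (Nat.cast_nonneg k) (hc0 k hk)
    · filter_upwards [eventually_ge_atTop 2] with k hk
      have := mul_le_mul_of_nonneg_left (hc1 k hk) (Nat.cast_nonneg (α := ℝ) k)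
      linarith
  have hpow : ∀ k, 2 ≤ k → Cc k * η k ^ (2 * k + 1) = c k * η k ^ 2 := fun k hk => by
    have : 2 * k + 1 = 2 * k - 1 + 2 := by omega
    rw [hc, this, pow_add]
    ring
  have hH : Tendsto (fun k => Hh k (η k)) atTop (nhds 1) := by
    have : Tendsto (fun k => 1 - η k - c k * η k ^ 2) atTop (nhds (1 - 0 - 0 * 0 ^ 2)) :=
      (hkη.const_sub 1).sub (hclim.mul (hkη.pow 2))
    rw [show (1 : ℝ) - 0 - 0 * 0 ^ 2 = 1 by norm_num] at this
    refine this.congr' ?_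
    filter_upwards [eventually_ge_atTop 2] with k hk
    rw [Hh, hpow k hk]
  have hkη2 : Tendsto (fun k : ℕ => (k : ℝ) * η k ^ 2) atTop (nhds (1 / 8)) := by
    have : Tendsto (fun k => (1 - 2 * η k - 7 * η k ^ 2 + 4 * (c k * η k ^ 2) * Hh k (η k)) / 8)
        atTop (nhds ((1 - 2 * 0 - 7 * 0 ^ 2 + 4 * (0 * 0 ^ 2) * 1) / 8)) :=
      (((((hkη.const_mul 2).const_sub 1).sub ((hkη.pow 2).const_mul 7)).add
        (((hclim.mul (hkη.pow 2)).const_mul 4).mul hH)).div_const 8)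
    rw [show ((1 : ℝ) - 2 * 0 - 7 * 0 ^ 2 + 4 * (0 * 0 ^ 2) * 1) / 8 = 1 / 8 by norm_num] at this
    refine this.congr' ?_
    filter_upwards [eventually_ge_atTop 2] with k hk
    have h0 := (hη k hk).2.1
    rw [Dd, Pp, mul_assoc 4 (Cc k), hpow k hk] at h0
    linarith
  have hG : Tendsto (fun k => Gg k (η k)) atTop (nhds 2) := by
    have : Tendsto (fun k => 2 - c k * (Hh k (η k) - c k)) atTop (nhds (2 - 0 * (1 - 0))) :=
      (hclim.mul (hH.sub hclim)).const_sub 2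
    rw [zero_mul, sub_zero] at this
    exact this
  have hpsi : Tendsto (fun k => psi k (η k)) atTop (nhds 2) := by
    have : Tendsto (fun k => 2 * η k + 14 * η k ^ 2 + 16 * ((k : ℝ) * η k ^ 2)
        - 4 * (2 * (k * c k) + c k) * η k ^ 2 * Hh k (η k)
        + 4 * c k * η k ^ 3 * (1 + (2 * (k * c k) + c k) * η k)) atTop
        (nhds (2 * 0 + 14 * 0 ^ 2 + 16 * (1 / 8) - 4 * (2 * 0 + 0) * 0 ^ 2 * 1
          + 4 * 0 * 0 ^ 3 * (1 + (2 * 0 + 0) * 0))) := by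
      have hs := (hkclim.const_mul 2).add hclim
      exact ((((hkη.const_mul 2).add ((hkη.pow 2).const_mul 14)).add (hkη2.const_mul 16)).sub
        (((hs.const_mul 4).mul (hkη.pow 2)).mul hH)).add
        (((hclim.const_mul 4).mul (hkη.pow 3)).mul ((hs.mul hkη).const_add 1))
    norm_num at this
    refine this.congr' ?_
    filter_upwards [eventually_ge_atTop 2] with k hk
    rw [psi_eq (by omega)]
  have := ((hkη2.const_mul 4).mul hG).div hpsi two_ne_zero
  norm_num at this
  refine Tendsto.congr (fun k => ?_) (by simpa using this)
  simp only [Pi.div_apply]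
  ring

namespace RegEx

/-- The defect of an expression: stars count once and `ε` counts twice. -/
def defect {A : Type} : RegEx A → ℕ
  | eps => 2
  | char _ => 0
  | plus l r => defect l + defect r
  | cat l r => defect l + defect r
  | star e => defect e + 1

theorem defect_add_two_mul_letters {A : Type} (e : RegEx A) :
    defect e + 2 * letters e = size e + 1 := by
  induction e <;> simp only [defect, letters, size] <;> omega

/-- The top constructor of an expression together with its arguments. -/
def ofNode {A : Type} :
    Unit ⊕ A ⊕ (RegEx A × RegEx A) ⊕ (RegEx A × RegEx A) ⊕ RegEx A → RegEx A
  | .inl _ => eps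
  | .inr (.inl a) => char a
  | .inr (.inr (.inl p)) => plus p.1 p.2
  | .inr (.inr (.inr (.inl p))) => cat p.1 p.2
  | .inr (.inr (.inr (.inr e))) => star e

theorem ofNode_injective {A : Type} : Function.Injective (ofNode (A := A)) := by
  rintro (x | x | x | x | x) (y | y | y | y | y) h <;>
    simp_all [ofNode, Prod.ext_iff]

/-- The finite set of expressions of depth less than `d`. -/
def ofDepth (A : Type) [Fintype A] : ℕ → Finset (RegEx A)
  | 0 => ∅
  | d + 1 => ((Finset.univ : Finset Unit).disjSum ((Finset.univ : Finset A).disjSum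
      ((ofDepth A d ×ˢ ofDepth A d).disjSum ((ofDepth A d ×ˢ ofDepth A d).disjSum
        (ofDepth A d))))).map ⟨ofNode, ofNode_injective⟩

theorem mem_ofDepth {A : Type} [Fintype A] (e : RegEx A) {d : ℕ} (h : size e ≤ d) :
    e ∈ ofDepth A d := by
  induction e generalizing d with
  | eps =>
    obtain ⟨d, rfl⟩ : ∃ j, d = j + 1 := ⟨d - 1, by simp only [size] at h; omega⟩
    exact Finset.mem_map.2 ⟨.inl (), by simp, rfl⟩
  | char a =>
    obtain ⟨d, rfl⟩ : ∃ j, d = j + 1 := ⟨d - 1, by simp only [size] at h; omega⟩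
    exact Finset.mem_map.2 ⟨.inr (.inl a), by simp, rfl⟩
  | plus l r ihl ihr =>
    simp only [size] at h
    obtain ⟨d, rfl⟩ : ∃ j, d = j + 1 := ⟨d - 1, by omega⟩
    exact Finset.mem_map.2 ⟨.inr (.inr (.inl (l, r))),
      by simp [ihl (d := d) (by omega), ihr (d := d) (by omega)], rfl⟩
  | cat l r ihl ihr =>
    simp only [size] at h
    obtain ⟨d, rfl⟩ : ∃ j, d = j + 1 := ⟨d - 1, by omega⟩
    exact Finset.mem_map.2 ⟨.inr (.inr (.inr (.inl (l, r)))),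
      by simp [ihl (d := d) (by omega), ihr (d := d) (by omega)], rfl⟩
  | star e ih =>
    simp only [size] at h
    obtain ⟨d, rfl⟩ : ∃ j, d = j + 1 := ⟨d - 1, by omega⟩
    exact Finset.mem_map.2 ⟨.inr (.inr (.inr (.inr e))),
      by simp [ih (d := d) (by omega)], rfl⟩

open scoped Classical in
/-- The finite set of expressions of size `n` avoiding `Σ⋆` in unions. -/
noncomputable def avoiding (k n : ℕ) : Finset (RegEx (Fin k)) :=
  (ofDepth (Fin k) n).filter fun e => Avoids e ∧ size e = n

theorem mem_avoiding {k n : ℕ} {e : RegEx (Fin k)} :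
    e ∈ avoiding k n ↔ Avoids e ∧ size e = n := by
  simp only [avoiding, Finset.mem_filter, and_iff_right_iff_imp]
  exact fun h => mem_ofDepth e h.2.le

theorem Rcount_eq (k n : ℕ) : Rcount k n = (avoiding k n).card :=
  Nat.subtype_card _ fun _ => mem_avoiding

theorem Lcount_eq (k n : ℕ) : Lcount k n = ∑ e ∈ avoiding k n, letters e := by
  have h : Lcount k n = (((avoiding k n).sigma fun e => Finset.range (letters e)).map
      (Equiv.sigmaEquivProd (RegEx (Fin k)) ℕ).toEmbedding).card := by
    refine Nat.subtype_card _ ?_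
    rintro ⟨e, i⟩
    simp [mem_avoiding, and_assoc]
  rw [h, Finset.card_map, Finset.card_sigma]
  simp

/-- The weight `e^{defect} z^{size}` of an expression. -/
noncomputable def weight {A : Type} (z : ℝ) (e : RegEx A) : ℝ :=
  Real.exp (defect e) * z ^ size e

theorem weight_nonneg {A : Type} {z : ℝ} (hz : 0 ≤ z) (e : RegEx A) : 0 ≤ weight z e := by
  unfold weight
  positivity

theorem sum_weight_ofDepth_succ (A : Type) [Fintype A] (z : ℝ) (d : ℕ) :
    ∑ e ∈ ofDepth A (d + 1), weight z e = (Real.exp 2 + Fintype.card A) * z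
      + 2 * z * (∑ e ∈ ofDepth A d, weight z e) ^ 2
      + Real.exp 1 * z * ∑ e ∈ ofDepth A d, weight z e := by
  have h2 : ∑ p ∈ ofDepth A d ×ˢ ofDepth A d, z * (weight z p.1 * weight z p.2)
      = z * (∑ e ∈ ofDepth A d, weight z e) ^ 2 := by
    rw [← Finset.mul_sum, sq, Finset.sum_mul_sum, Finset.sum_product]
  have hp : ∀ l r : RegEx A, weight z (plus l r) = z * (weight z l * weight z r) := fun l r => by
    simp only [weight, defect, size, Nat.cast_add, Real.exp_add, pow_add, pow_one]
    ring
  have hc : ∀ l r : RegEx A, weight z (cat l r) = z * (weight z l * weight z r) := fun l r => by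
    simp only [weight, defect, size, Nat.cast_add, Real.exp_add, pow_add, pow_one]
    ring
  have hs : ∀ e : RegEx A, weight z (star e) = Real.exp 1 * z * weight z e := fun e => by
    simp only [weight, defect, size, Nat.cast_add, Nat.cast_one, Real.exp_add, pow_add, pow_one]
    ring
  have h0 : weight z (eps : RegEx A) = Real.exp 2 * z := by simp [weight, defect, size]
  have h1 : ∀ a : A, weight z (char a) = z := fun a => by simp [weight, defect, size]
  simp only [ofDepth, Finset.sum_map, Finset.sum_disjSum, Function.Embedding.coeFn_mk, ofNode,
    hp, hc, hs, h0, h1, h2, ← Finset.mul_sum]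
  simp
  ring

theorem sum_weight_ofDepth_le (A : Type) [Fintype A] {z B : ℝ} (hz : 0 ≤ z) (hB : 0 ≤ B)
    (h : (Real.exp 2 + Fintype.card A) * z + 2 * z * B ^ 2 + Real.exp 1 * z * B ≤ B) (d : ℕ) :
    ∑ e ∈ ofDepth A d, weight z e ≤ B := by
  induction d with
  | zero => simpa [ofDepth] using hB
  | succ d ih =>
    have h0 : 0 ≤ ∑ e ∈ ofDepth A d, weight z e :=
      Finset.sum_nonneg fun e _ => weight_nonneg hz e
    rw [sum_weight_ofDepth_succ]
    refine le_trans ?_ h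
    gcongr

theorem sum_exp_defect_avoiding_le (k n : ℕ) :
    ∑ e ∈ avoiding k n, Real.exp (defect e)
      ≤ (Real.sqrt (8 * k) + 9) / 4 * (Real.sqrt (8 * k) + 12) ^ n := by
  set x := Real.sqrt (8 * k) with hx
  have hx0 : 0 ≤ x := Real.sqrt_nonneg _
  have hx2 : x ^ 2 = 8 * k := Real.sq_sqrt (by positivity)
  have he : Real.exp 1 < 2.72 := lt_trans Real.exp_one_lt_d9 (by norm_num)
  have he2 : Real.exp 2 < 8 := by
    rw [show (2 : ℝ) = 1 + 1 by norm_num, Real.exp_add]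
    nlinarith [Real.exp_pos 1]
  have hy : 0 < x + 12 := by linarith
  have key := sum_weight_ofDepth_le (Fin k) (z := (x + 12)⁻¹) (B := (x + 9) / 4)
    (by positivity) (by positivity) (by
      rw [Fintype.card_fin, ← mul_le_mul_iff_right₀ hy]
      have : (x + 12) * ((Real.exp 2 + k) * (x + 12)⁻¹ + 2 * (x + 12)⁻¹ * ((x + 9) / 4) ^ 2
          + Real.exp 1 * (x + 12)⁻¹ * ((x + 9) / 4))
          = Real.exp 2 + k + 2 * ((x + 9) / 4) ^ 2 + Real.exp 1 * ((x + 9) / 4) := by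
        field_simp
      rw [this]
      nlinarith) n
  have hsub : ∑ e ∈ avoiding k n, weight (x + 12)⁻¹ e ≤ (x + 9) / 4 :=
    (Finset.sum_le_sum_of_subset_of_nonneg
      (fun e he => mem_ofDepth e (mem_avoiding.1 he).2.le)
      fun e _ _ => weight_nonneg (by positivity) e).trans key
  have hw : ∑ e ∈ avoiding k n, weight (x + 12)⁻¹ e
      = (∑ e ∈ avoiding k n, Real.exp (defect e)) * ((x + 12) ^ n)⁻¹ := by
    rw [Finset.sum_mul]
    refine Finset.sum_congr rfl fun e he => ?_
    rw [weight, (mem_avoiding.1 he).2, inv_pow]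
  rwa [hw, ← div_eq_mul_inv, div_le_iff₀ (by positivity)] at hsub

/-- The shape of the syntax tree of an expression without stars. -/
def shape {A : Type} : RegEx A → BinaryTree Unit
  | eps => .nil
  | char _ => .nil
  | plus l r => .node () (shape l) (shape r)
  | cat l r => .node () (shape l) (shape r)
  | star _ => .nil

/-- The expressions of a given shape all of whose leaves are letters, without stars. -/
def ofShape (A : Type) [Fintype A] : BinaryTree Unit → Finset (RegEx A)
  | .nil => Finset.univ.map ⟨fun a => ofNode (.inr (.inl a)), fun a b h => by
      simpa using ofNode_injective h⟩
  | .node _ l r => ((ofShape A l ×ˢ ofShape A r).disjSum (ofShape A l ×ˢ ofShape A r)).map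
      ⟨fun p => ofNode (.inr (.inr (p.elim .inl fun q => .inr (.inl q)))), by
        rintro (p | p) (q | q) h <;> simpa using ofNode_injective h⟩

theorem card_ofShape (A : Type) [Fintype A] (t : BinaryTree Unit) :
    (ofShape A t).card = 2 ^ t.numNodes * Fintype.card A ^ (t.numNodes + 1) := by
  induction t with
  | nil => simp [ofShape]
  | node _ l r ihl ihr =>
    simp only [ofShape, Finset.card_map, Finset.card_disjSum, Finset.card_product, ihl, ihr,
      BinaryTree.numNodes]
    ring

theorem ofShape_spec {A : Type} [Fintype A] (t : BinaryTree Unit) {e : RegEx A}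
    (he : e ∈ ofShape A t) :
    shape e = t ∧ size e = 2 * t.numNodes + 1 ∧ Avoids e ∧ ¬ IsSigmaStar e := by
  induction t generalizing e with
  | nil =>
    obtain ⟨a, -, rfl⟩ := Finset.mem_map.1 he
    simp [ofNode, shape, size, Avoids, IsSigmaStar]
  | node _ l r ihl ihr =>
    obtain ⟨p | p, hp, rfl⟩ := Finset.mem_map.1 he <;>
    · simp only [Finset.inl_mem_disjSum, Finset.inr_mem_disjSum, Finset.mem_product] at hp
      obtain ⟨h1, h2, h3, h4⟩ := ihl hp.1
      obtain ⟨h5, h6, h7, h8⟩ := ihr hp.2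
      refine ⟨?_, ?_, ?_, ?_⟩
      · simp [ofNode, shape, h1, h5]
      · simp [ofNode, size, h2, h6, BinaryTree.numNodes]
        omega
      · simp [ofNode, Avoids, h3, h4, h7, h8]
      · simp [ofNode, IsSigmaStar]

theorem catalan_mul_le_card_avoiding (k m : ℕ) :
    catalan m * (2 ^ m * k ^ (m + 1)) ≤ (avoiding k (2 * m + 1)).card := by
  classical
  have hdisj : (BinaryTree.treesOfNumNodesEq m : Set (BinaryTree Unit)).PairwiseDisjoint
      (ofShape (Fin k)) := by
    intro s _ t _ hst
    refine Finset.disjoint_left.2 fun e hs ht => hst ?_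
    rw [← (ofShape_spec s hs).1, (ofShape_spec t ht).1]
  have hcard : ((BinaryTree.treesOfNumNodesEq m).biUnion (ofShape (Fin k))).card
      = catalan m * (2 ^ m * k ^ (m + 1)) := by
    rw [Finset.card_biUnion hdisj, ← BinaryTree.treesOfNumNodesEq_card_eq_catalan, ← smul_eq_mul]
    refine Finset.sum_eq_card_nsmul fun t ht => ?_
    rw [card_ofShape, BinaryTree.mem_treesOfNumNodesEq.1 ht, Fintype.card_fin]
  rw [← hcard]
  refine Finset.card_le_card fun e he => ?_
  obtain ⟨t, ht, het⟩ := Finset.mem_biUnion.1 he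
  obtain ⟨-, h2, h3, -⟩ := ofShape_spec t het
  rw [BinaryTree.mem_treesOfNumNodesEq.1 ht] at h2
  exact mem_avoiding.2 ⟨h3, h2⟩

theorem sqrt_pow_le_card_avoiding {k m : ℕ} (hk : 1 ≤ k) (hm : 1 ≤ m) :
    Real.sqrt (8 * k) ^ (2 * m + 1)
      ≤ 4 * ((2 * m + 1 : ℕ) : ℝ) ^ 2 * (avoiding k (2 * m + 1)).card := by
  have h1 := catalan_mul_le_card_avoiding k m
  have h2 := Nat.four_pow_le_two_mul_self_mul_centralBinom m hm
  rw [← succ_mul_catalan_eq_centralBinom] at h2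
  have h3 : (8 * k) ^ m * (8 * k) ≤ 4 * (2 * m + 1) ^ 2 * (avoiding k (2 * m + 1)).card := by
    calc (8 * k) ^ m * (8 * k) = 4 ^ m * (8 * (2 ^ m * k ^ (m + 1))) := by
          rw [show 8 * k = 4 * (2 * k) by ring, mul_pow, mul_pow]
          ring
      _ ≤ 2 * m * ((m + 1) * catalan m) * (8 * (2 ^ m * k ^ (m + 1))) :=
          Nat.mul_le_mul_right _ h2
      _ = 16 * m * (m + 1) * (catalan m * (2 ^ m * k ^ (m + 1))) := by ring
      _ ≤ 4 * (2 * m + 1) ^ 2 * (avoiding k (2 * m + 1)).card := by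
          refine Nat.mul_le_mul ?_ h1
          nlinarith
  have hk' : (1 : ℝ) ≤ k := by exact_mod_cast hk
  have h4 : Real.sqrt (8 * k) ≤ 8 * k := Real.sqrt_le_self_iff.2 (Or.inr (by linarith))
  have h5 : Real.sqrt (8 * k) ^ 2 = 8 * k := Real.sq_sqrt (by positivity)
  rw [pow_succ, pow_mul, h5]
  calc (8 * k : ℝ) ^ m * Real.sqrt (8 * k) ≤ (8 * k : ℝ) ^ m * (8 * k) := by gcongr
    _ ≤ _ := by exact_mod_cast h3

theorem two_mul_Lcount_le (k n : ℕ) : 2 * Lcount k n ≤ (n + 1) * Rcount k n := by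
  rw [Lcount_eq, Rcount_eq, Finset.mul_sum, mul_comm, ← smul_eq_mul]
  refine Finset.sum_le_card_nsmul _ _ _ fun e he => ?_
  have := defect_add_two_mul_letters e
  rw [(mem_avoiding.1 he).2] at this
  omega

theorem le_two_mul_Lcount (k n : ℕ) (t : ℝ) :
    (n + 1 - t) * Rcount k n - Real.exp (-t) * ∑ e ∈ avoiding k n, Real.exp (defect e)
      ≤ 2 * Lcount k n := by
  rw [Lcount_eq, Rcount_eq, Nat.cast_sum, Finset.mul_sum, Finset.mul_sum, mul_comm,
    ← nsmul_eq_mul, ← Finset.sum_const, ← Finset.sum_sub_distrib]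
  refine Finset.sum_le_sum fun e he => ?_
  have h1 := defect_add_two_mul_letters e
  rw [(mem_avoiding.1 he).2] at h1
  have h2 : (defect e : ℝ) + 2 * letters e = n + 1 := by exact_mod_cast h1
  have h3 := Real.add_one_le_exp (-t + defect e)
  rw [Real.exp_add] at h3
  linarith

theorem ratio_le {k n : ℕ} (hn : 1 ≤ n) :
    (Lcount k n : ℝ) / (n * Rcount k n) ≤ 1 / 2 + 1 / 2 * (1 / (n : ℝ)) := by
  have hn' : (0 : ℝ) < n := by exact_mod_cast hn
  rcases Nat.eq_zero_or_pos (Rcount k n) with h | h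
  · rw [h, Nat.cast_zero, mul_zero, div_zero]
    positivity
  have hR : (0 : ℝ) < Rcount k n := by exact_mod_cast h
  have h1 : (2 * Lcount k n : ℝ) ≤ (n + 1) * Rcount k n := by exact_mod_cast two_mul_Lcount_le k n
  rw [div_le_iff₀ (by positivity)]
  calc (Lcount k n : ℝ) ≤ (n + 1) * Rcount k n / 2 := by linarith
    _ = _ := by field_simp

theorem le_ratio {k m : ℕ} (hk : 1 ≤ k) (hm : 1 ≤ m) (ε : ℝ) :
    1 / 2 - ε / 2 - (Real.sqrt (8 * k) + 9) / 2 * (((2 * m + 1 : ℕ) : ℝ)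
        * (Real.exp (-ε) * ((Real.sqrt (8 * k) + 12) / Real.sqrt (8 * k))) ^ (2 * m + 1))
      ≤ (Lcount k (2 * m + 1) : ℝ) / (((2 * m + 1 : ℕ) : ℝ) * Rcount k (2 * m + 1)) := by
  have h1 := sqrt_pow_le_card_avoiding hk hm
  rw [← Rcount_eq] at h1
  have hn : (1 : ℝ) ≤ ((2 * m + 1 : ℕ) : ℝ) := by exact_mod_cast Nat.le_add_left 1 _
  have h2 := le_two_mul_Lcount k (2 * m + 1) (ε * ((2 * m + 1 : ℕ) : ℝ))
  have h3 := sum_exp_defect_avoiding_le k (2 * m + 1)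
  have hk' : (1 : ℝ) ≤ k := by exact_mod_cast hk
  have hx : 0 < Real.sqrt (8 * k) := by positivity
  generalize 2 * m + 1 = n at *
  set x := Real.sqrt (8 * k) with hxdef
  have hR : (0 : ℝ) < Rcount k n := by
    by_contra! h0
    have : 4 * (n : ℝ) ^ 2 * Rcount k n ≤ 0 := mul_nonpos_of_nonneg_of_nonpos (by positivity) h0
    have := pow_pos hx n
    linarith
  have hexp : Real.exp (-(ε * n)) = Real.exp (-ε) ^ n := by
    rw [← Real.exp_nat_mul]
    ring_nf
  have h4 : Real.exp (-(ε * n)) * ∑ e ∈ avoiding k n, Real.exp (defect e)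
      ≤ (x + 9) * (n ^ 2 * (Real.exp (-ε) * ((x + 12) / x)) ^ n) * Rcount k n := by
    calc Real.exp (-(ε * n)) * ∑ e ∈ avoiding k n, Real.exp (defect e)
        ≤ Real.exp (-(ε * n)) * ((x + 9) / 4 * (x + 12) ^ n) := by gcongr
      _ = (x + 9) / 4 * (Real.exp (-ε) * ((x + 12) / x)) ^ n * x ^ n := by
          rw [hexp, mul_pow, div_pow]
          field_simp
      _ ≤ (x + 9) / 4 * (Real.exp (-ε) * ((x + 12) / x)) ^ n * (4 * (n : ℝ) ^ 2 * Rcount k n) := by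
          gcongr
      _ = _ := by ring
  rw [le_div_iff₀ (by positivity)]
  nlinarith

theorem tendsto_half_of_tendsto_ratio {L : ℕ → ℝ}
    (hL : ∀ k, 2 ≤ k → Tendsto (fun n : ℕ => (Lcount k n : ℝ) / ((n : ℝ) * (Rcount k n : ℝ)))
      atTop (nhds (L k))) :
    Tendsto L atTop (nhds (1 / 2)) := by
  have hupper : ∀ k, 2 ≤ k → L k ≤ 1 / 2 := fun k hk => by
    have hlim : Tendsto (fun n : ℕ => 1 / 2 + 1 / 2 * (1 / (n : ℝ))) atTop (nhds (1 / 2)) := by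
      have := ((tendsto_one_div_atTop_nhds_zero_nat (𝕜 := ℝ)).const_mul (1 / 2)).const_add (1 / 2)
      rwa [mul_zero, add_zero] at this
    refine le_of_tendsto_of_tendsto (hL k hk) hlim ?_
    filter_upwards [eventually_ge_atTop 1] with n hn using ratio_le hn
  have hsqrt : Tendsto (fun k : ℕ => Real.sqrt (8 * k)) atTop atTop :=
    Real.tendsto_sqrt_atTop.comp (tendsto_natCast_atTop_atTop.const_mul_atTop (by norm_num))
  have hlower : ∀ ε : ℝ, 0 < ε → ∀ᶠ k in atTop, 1 / 2 - ε / 2 ≤ L k := fun ε hε => by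
    have hq : Tendsto (fun k : ℕ => Real.exp (-ε) * (1 + 12 * (Real.sqrt (8 * k))⁻¹)) atTop
        (nhds (Real.exp (-ε) * (1 + 12 * 0))) :=
      (((tendsto_inv_atTop_zero.comp hsqrt).const_mul 12).const_add 1).const_mul _
    have hlt : Real.exp (-ε) * (1 + 12 * 0) < 1 := by
      rw [mul_zero, add_zero, mul_one, Real.exp_lt_one_iff]
      linarith
    filter_upwards [hq.eventually_lt_const hlt, eventually_ge_atTop 2] with k hk hk2
    have hx : 0 < Real.sqrt (8 * k) := by
      have : (0 : ℝ) < k := by exact_mod_cast (by omega : 0 < k)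
      positivity
    have hq' : Real.exp (-ε) * ((Real.sqrt (8 * k) + 12) / Real.sqrt (8 * k)) < 1 := by
      rwa [add_div, div_self hx.ne', div_eq_mul_inv]
    have hodd : Tendsto (fun m : ℕ => 2 * m + 1) atTop atTop :=
      tendsto_atTop_mono (fun m => (by omega : m ≤ 2 * m + 1)) tendsto_id
    have hlim := ((((tendsto_self_mul_const_pow_of_lt_one (by positivity) hq').comp hodd).const_mul
      ((Real.sqrt (8 * k) + 9) / 2)).const_sub (1 / 2 - ε / 2))
    rw [mul_zero, sub_zero] at hlim
    refine le_of_tendsto_of_tendsto hlim ((hL k hk2).comp hodd) ?_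
    filter_upwards [eventually_ge_atTop 1] with m hm
    exact le_ratio (by omega) hm ε
  refine tendsto_order.2 ⟨fun a ha => ?_, fun a ha => ?_⟩
  · filter_upwards [hlower (1 / 2 - a) (by linarith)] with k hk
    linarith
  · filter_upwards [eventually_ge_atTop 2] with k hk using (hupper k hk).trans_lt ha

end RegEx

/-- `lim_{k→∞} 4·k·η_k²·g_k(η_k)/ψ_k(η_k) = 1/2`; consequently, in
regular expressions without `Σ⋆` in unions, the asymptotic ratio
`lim_{n→∞} ℓ_n/(n·R_n)` of letters tends to `1/2` as the alphabet size `k` tends to `∞`. -/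
theorem statement18 (η : ℕ → ℝ) (hη : ∀ k, 2 ≤ k → IsEta k (η k)) :
    Tendsto (fun k : ℕ => 4 * (k : ℝ) * η k ^ 2 * Gg k (η k) / psi k (η k))
      atTop (nhds (1 / 2)) ∧
    ∀ L : ℕ → ℝ,
      (∀ k, 2 ≤ k →
        Tendsto (fun n : ℕ => (Lcount k n : ℝ) / ((n : ℝ) * (Rcount k n : ℝ)))
          atTop (nhds (L k))) →
      Tendsto L atTop (nhds (1 / 2)) := by
  exact ⟨tendsto_letters_ratio η hη, fun _ hL => RegEx.tendsto_half_of_tendsto_ratio hL⟩
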